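/- Let (A,·,[·,·],α) be a coherence Hom-F-manifold algebra over a field K of characteristic 0 with α bijective, α(x·y) = α(x)·α(y) and α([x,y]) = [α(x),α(y)] for all x,y ∈ A. Define ad(x)(y) = [x,y], L(x)(y) = x·y, ad★, L★ : A → End(A*) by ⟨ad★(x)ξ, y⟩ = −⟨ξ, α⁻²([α(x), y])⟩ and ⟨L★(x)ξ, y⟩ = −⟨ξ, α⁻²(α(x)·y)⟩, and (α⁻¹)* : A* → A* by ⟨(α⁻¹)*ξ, y⟩ = ⟨ξ, α⁻¹(y)⟩. Then (A*; ad★, −L★, (α⁻¹)*) is a representation of the Hom-F-manifold algebra A (the coadjoint representation). -/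

import Mathlib

/-- The Hom-Leibnizator `L(x,y,z) = [α(x), y·z] − [x,y]·α(z) − α(y)·[x,z]`. -/
def homLeib {A : Type*} [AddCommGroup A] (mul br : A → A → A) (α : A → A)
    (x y z : A) : A :=
  br (α x) (mul y z) - mul (br x y) (α z) - mul (α y) (br x z)

/-- `(A, mul, br, α)` is a Hom-F-manifold algebra. -/
def IsHomFManifold {A : Type*} [AddCommGroup A] (mul br : A → A → A) (α : A → A) : Prop :=
  (∀ x y, mul x y = mul y x) ∧
  (∀ x y z, mul (α x) (mul y z) = mul (mul x y) (α z)) ∧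
  (∀ x y, br x y = - br y x) ∧
  (∀ x y z, br (α x) (br y z) + br (α y) (br z x) + br (α z) (br x y) = 0) ∧
  (∀ x y z w, homLeib mul br α (mul x y) (α z) (α w) =
      mul (α (α x)) (homLeib mul br α y z w) + mul (α (α y)) (homLeib mul br α x z w))
/-- `L₁(x,y,u) = ρ(α(x))μ(y)u − μ(α(y))ρ(x)u − μ([x,y])φ(u)`. -/
def repL1 {A V : Type*} [AddCommGroup A] [AddCommGroup V]
    (br : A → A → A) (α : A → A) (ρ μ : A → V → V) (φ : V → V) (x y : A) (u : V) : V :=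
  ρ (α x) (μ y u) - μ (α y) (ρ x u) - μ (br x y) (φ u)

/-- `L₂(x,y,u) = μ(α(x))ρ(y)u + μ(α(y))ρ(x)u − ρ(x·y)φ(u)`. -/
def repL2 {A V : Type*} [AddCommGroup A] [AddCommGroup V]
    (mul : A → A → A) (α : A → A) (ρ μ : A → V → V) (φ : V → V) (x y : A) (u : V) : V :=
  μ (α x) (ρ y u) + μ (α y) (ρ x u) - ρ (mul x y) (φ u)

/-- `(V;ρ,μ,φ)` is a representation of the Hom-F-manifold algebra `(A,mul,br,α)`. -/
def IsHomFManifoldRep {A V : Type*} [AddCommGroup A] [AddCommGroup V]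
    (mul br : A → A → A) (α : A → A) (ρ μ : A → V → V) (φ : V → V) : Prop :=
  -- ρ is a representation of the Hom-Lie algebra (A,br,α)
  (∀ x v, ρ (α x) (φ v) = φ (ρ x v)) ∧
  (∀ x y v, ρ (br x y) (φ v) = ρ (α x) (ρ y v) - ρ (α y) (ρ x v)) ∧
  -- μ is a representation of the commutative Hom-associative algebra (A,mul,α)
  (∀ x v, μ (α x) (φ v) = φ (μ x v)) ∧
  (∀ x y v, μ (mul x y) (φ v) = μ (α x) (μ y v)) ∧
  -- the two compatibility conditions
  (∀ x y z u, repL1 br α ρ μ φ (mul x y) (α z) (φ u) =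
      μ (α (α x)) (repL1 br α ρ μ φ y z u) + μ (α (α y)) (repL1 br α ρ μ φ x z u)) ∧
  (∀ x y z u, μ (homLeib mul br α x y z) (φ (φ u)) =
      repL2 mul α ρ μ φ (α y) (α z) (μ x u) - μ (α (α x)) (repL2 mul α ρ μ φ y z u))

/-- `K(x,y,z) = [α(x), y·z] + [α(y), z·x] + [α(z), x·y]`. -/
def homKmap {A : Type*} [AddCommGroup A] (mul br : A → A → A) (α : A → A)
    (x y z : A) : A :=
  br (α x) (mul y z) + br (α y) (mul z x) + br (α z) (mul x y)

/-- The "star" dual construction: `⟨(dualStar αinv g) ξ, y⟩ = −⟨ξ, αinv (αinv (g y))⟩`. -/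
def dualStar {K A : Type*} [Field K] [AddCommGroup A] [Module K A]
    (αinv : A →ₗ[K] A) (g : A →ₗ[K] A) (ξ : Module.Dual K A) : Module.Dual K A :=
  -(ξ.comp ((αinv.comp αinv).comp g))

/-- The sum of the three cyclic Leibnizators of a skew-symmetric bracket with respect to a
commutative product. -/
theorem homKmap_id_eq {K A : Type*} [Field K] [AddCommGroup A] [Module K A]
    (m b : A →ₗ[K] A →ₗ[K] A) (hm : ∀ x y, m x y = m y x) (hb : ∀ x y, b x y = -b y x)
    (x y z : A) :
    homKmap (fun x y => m x y) (fun x y => b x y) id x y z =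
      homLeib (fun x y => m x y) (fun x y => b x y) id x y z +
      homLeib (fun x y => m x y) (fun x y => b x y) id y z x +
      homLeib (fun x y => m x y) (fun x y => b x y) id z x y := by
  simp only [homKmap, homLeib, id]
  rw [hb y x, hb z x, hb z y, hm y (b x z), hm z (-b x y), hm x (-b y z)]
  simp only [map_neg, LinearMap.neg_apply]
  abel

/-- Elimination of the terms `P y z (m x w)` from the twisted second coherence condition. -/
theorem two_smul_twisted_mul {K A : Type*} [Field K] [CharZero K]
    [AddCommGroup A] [Module K A]
    (m : A →ₗ[K] A →ₗ[K] A) (P : A → A → A → A) (β : A → A)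
    (hm : ∀ x y, m x y = m y x) (hs : ∀ x y z, P x y z = P x z y)
    (hl : ∀ x y z w, P (m x y) z w = m x (P y z w) + m y (P x z w))
    (h1 : ∀ x y z w, P (m x y) z w = P y z (m x w) + P x z (m y w))
    (h2 : ∀ x y z w, m (P x y z) w =
      (P y z (m x w) + P z (m x w) y + P (m x w) y z) -
        m (β x) (P y z w + P z w y + P w y z))
    (x y z w : A) :
    (2 : K) • m (β x) (P y z w + P z w y + P w y z) =
      m x (P y z w + P z w y + P w y z) + m y (P x z w + P z w x + P w x z) +
      m z (P x y w + P y w x + P w x y) + m w (P x y z + P y z x + P z x y) -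
      (m x (P w y z) + m w (P x y z) + m y (P z x w) + m z (P y x w)) -
      (2 : K) • m w (P x y z) := by
  have hsum : ∀ x y z w, P y z (m x w) + P x z (m y w) = m x (P y z w) + m y (P x z w) :=
    fun x y z w => (h1 x y z w).symm.trans (hl x y z w)
  have e := h2 x y z w
  rw [hl, hm (P x y z), hs z (m x w)] at e
  have a1 := hsum x y z w
  have a2 := hsum y w z x
  have a3 := hsum x w z y
  have c1 := hsum x z y w
  have c2 := hsum z w y x
  have c3 := hsum x w y z
  rw [hm w x, hm y x] at a2
  rw [hm w x, hm z x] at c2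
  rw [hm w y] at a3
  rw [hm w z] at c3
  simp only [hs x z y, hs y z x, hs y w x, hs z y x, hs z w x, hs z w y, hs w y x, hs w z x,
    hs w z y, map_add] at *
  linear_combination (norm := module) (2 : K) • e + a1 + a2 - a3 + c1 + c2 - c3

/-- Under the first coherence condition, the second one, twisted by any map `β`, implies that
`β x` and `x` act in the same way on the values of the cyclic sum. -/
theorem twisted_mul_eq {K A : Type*} [Field K] [CharZero K]
    [AddCommGroup A] [Module K A]
    (m : A →ₗ[K] A →ₗ[K] A) (P : A → A → A → A) (β : A → A)
    (hm : ∀ x y, m x y = m y x) (hs : ∀ x y z, P x y z = P x z y)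
    (hl : ∀ x y z w, P (m x y) z w = m x (P y z w) + m y (P x z w))
    (h1 : ∀ x y z w, P (m x y) z w = P y z (m x w) + P x z (m y w))
    (h2 : ∀ x y z w, m (P x y z) w =
      (P y z (m x w) + P z (m x w) y + P (m x w) y z) -
        m (β x) (P y z w + P z w y + P w y z))
    (x y z w : A) :
    m (β x) (P y z w + P z w y + P w y z) = m x (P y z w + P z w y + P w y z) := by
  have e := two_smul_twisted_mul m P β hm hs hl h1 h2
  have exy := e x z w y
  have exz := e x y w z
  have exw := e x y z w
  have eyx := e y z w x
  have eyz := e y x w z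
  have eyw := e y x z w
  have ezx := e z y w x
  have ezy := e z x w y
  have ezw := e z x y w
  have ewx := e w y z x
  have ewy := e w x z y
  have ewz := e w x y z
  clear e
  simp only [hs x z y, hs x w y, hs x w z, hs y z x, hs y w x, hs y w z, hs z y x, hs z w x,
    hs z w y, hs w y x, hs w z x, hs w z y, map_add] at *
  linear_combination (norm := module)
    (-(1 / 2 : K)) • (eyx + ezx + ewx) + (1 / 6 : K) •
      (exy + exz + exw + eyx + eyz + eyw + ezx + ezy + ezw + ewx + ewy + ewz)

/-- the coadjoint representation `(A*; ad★, −L★, (α⁻¹)*)` of a coherence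
Hom-F-manifold algebra. -/
theorem coherence_homFManifold_coadjoint_rep {K A : Type*} [Field K] [CharZero K]
    [AddCommGroup A] [Module K A]
    (mul br : A →ₗ[K] A →ₗ[K] A) (α : A ≃ₗ[K] A)
    (hFM : IsHomFManifold (fun x y => mul x y) (fun x y => br x y) (fun x => α x))
    (hαm : ∀ x y : A, α (mul x y) = mul (α x) (α y))
    (hαb : ∀ x y : A, α (br x y) = br (α x) (α y))
    -- the two coherence conditions
    (hcoh1 : ∀ x y z w : A,
      homLeib (fun a b => mul a b) (fun a b => br a b) (fun a => α a) (mul x y) z (α w) =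
        homLeib (fun a b => mul a b) (fun a b => br a b) (fun a => α a) (α y) z (mul x w) +
        homLeib (fun a b => mul a b) (fun a b => br a b) (fun a => α a) (α x) z (mul y w))
    (hcoh2 : ∀ x y z w : A,
      mul (homLeib (fun a b => mul a b) (fun a b => br a b) (fun a => α a) x y z) (α (α w)) =
        homKmap (fun a b => mul a b) (fun a b => br a b) (fun a => α a) (α y) (α z) (mul x w) -
        mul (α x) (homKmap (fun a b => mul a b) (fun a b => br a b) (fun a => α a) y z w)) :
    IsHomFManifoldRep (fun x y => mul x y) (fun x y => br x y) (fun x => α x)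
      (fun x ξ => dualStar α.symm.toLinearMap (br (α x)) ξ)
      (fun x ξ => -(dualStar α.symm.toLinearMap (mul (α x)) ξ))
      (fun ξ => ξ.comp α.symm.toLinearMap) := by
  obtain ⟨m, rfl⟩ : ∃ m : A →ₗ[K] A →ₗ[K] A, mul = m.compr₂ α.toLinearMap :=
    ⟨mul.compr₂ α.symm.toLinearMap, by ext; simp⟩
  obtain ⟨b, rfl⟩ : ∃ b : A →ₗ[K] A →ₗ[K] A, br = b.compr₂ α.toLinearMap :=
    ⟨br.compr₂ α.symm.toLinearMap, by ext; simp⟩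
  simp only [LinearMap.compr₂_apply, LinearEquiv.coe_coe, EmbeddingLike.apply_eq_iff_eq]
    at hαm hαb
  have hm' : ∀ x y, α.symm (m x y) = m (α.symm x) (α.symm y) := fun x y => by
    rw [LinearEquiv.symm_apply_eq, hαm]; simp
  have hb' : ∀ x y, α.symm (b x y) = b (α.symm x) (α.symm y) := fun x y => by
    rw [LinearEquiv.symm_apply_eq, hαb]; simp
  obtain ⟨hm, hassoc, hb, hjac, hleib⟩ := hFM
  simp only [homLeib, homKmap, LinearMap.compr₂_apply, LinearEquiv.coe_coe, hαm, hαb, map_add,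
    map_sub] at hm hassoc hb hjac hleib hcoh1 hcoh2
  replace hm : ∀ x y, m x y = m y x := fun x y => by simpa using hm (α.symm x) (α.symm y)
  replace hb : ∀ x y, b x y = -b y x := fun x y => by simpa using hb (α.symm x) (α.symm y)
  replace hassoc : ∀ x y z, m x (m y z) = m (m x y) z := fun x y z => by
    simpa using hassoc (α.symm (α.symm x)) (α.symm (α.symm y)) (α.symm (α.symm z))
  replace hjac : ∀ x y z, b x (b y z) + b y (b z x) + b z (b x y) = 0 := fun x y z => by
    simpa using hjac (α.symm (α.symm x)) (α.symm (α.symm y)) (α.symm (α.symm z))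
  let P : A → A → A → A := homLeib (fun x y => m x y) (fun x y => b x y) id
  have hP : ∀ x y z, P x y z = b x (m y z) - m (b x y) z - m y (b x z) := fun _ _ _ => rfl
  have hPs : ∀ x y z, P x y z = P x z y := fun x y z => by
    rw [hP, hP, hm y z, hm (b x y) z, hm y (b x z)]
    abel
  replace hleib : ∀ x y z w, P (m x y) z w = m x (P y z w) + m y (P x z w) := fun x y z w => by
    have h := hleib (α.symm (α.symm (α.symm x))) (α.symm (α.symm (α.symm y)))
      (α.symm (α.symm (α.symm z))) (α.symm (α.symm (α.symm w)))
    simp only [LinearEquiv.apply_symm_apply] at h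
    simp only [hP, map_sub, h]
  replace hcoh1 : ∀ x y z w, P (m x y) z w = P y z (m x w) + P x z (m y w) := fun x y z w => by
    have h := hcoh1 (α.symm (α.symm (α.symm x))) (α.symm (α.symm (α.symm y)))
      (α.symm (α.symm z)) (α.symm (α.symm (α.symm w)))
    simp only [LinearEquiv.apply_symm_apply] at h
    simp only [hP, h]
  have hK : ∀ x y z, b x (m y z) + b y (m z x) + b z (m x y) = P x y z + P y z x + P z x y :=
    homKmap_id_eq m b hm hb
  have htw : ∀ x y z w, m (P x y z) w =
      (P y z (m x w) + P z (m x w) y + P (m x w) y z) -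
        m (α.symm x) (P y z w + P z w y + P w y z) := fun x y z w => by
    have h := hcoh2 (α.symm (α.symm (α.symm x))) (α.symm (α.symm (α.symm y)))
      (α.symm (α.symm (α.symm z))) (α.symm (α.symm (α.symm w)))
    simp only [LinearEquiv.apply_symm_apply] at h
    rw [← hK, ← hK, hP]
    simp only [map_sub, map_add, LinearMap.sub_apply, LinearMap.compr₂_apply,
      LinearEquiv.coe_coe, hαm, hαb, LinearEquiv.apply_symm_apply] at h ⊢
    exact h
  replace hcoh2 : ∀ x y z w, m (P x y z) w =
      (b y (m z (m x w)) + b z (m (m x w) y) + b (m x w) (m y z)) -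
        m x (b y (m z w) + b z (m w y) + b w (m y z)) := fun x y z w => by
    rw [htw, twisted_mul_eq m P α.symm hm hPs hleib hcoh1 htw, hK, hK]
  clear htw hleib
  simp only [hP] at hcoh1 hcoh2
  refine ⟨fun x ξ => ?_, fun x y ξ => ?_, fun x ξ => ?_, fun x y ξ => ?_, fun x y z ξ => ?_,
    fun x y z ξ => ?_⟩ <;> ext w <;>
  simp only [dualStar, repL1, repL2, homLeib, LinearMap.compr₂_apply, LinearEquiv.coe_coe,
    LinearMap.add_apply, LinearMap.sub_apply, LinearMap.neg_apply, LinearMap.comp_apply, neg_neg,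
    hαm, hαb, hm', hb', LinearEquiv.symm_apply_apply, LinearEquiv.apply_symm_apply, map_sub]
  · have h := congrArg ξ (hjac x y (α.symm (α.symm w)))
    rw [hb _ (b x y), hb _ x] at h
    simp only [map_add, map_neg, map_zero] at h
    linear_combination h
  · rw [hassoc y x, hm y x]
  · have h := congrArg ξ (hcoh1 x y z (α.symm (α.symm (α.symm w))))
    simp only [map_sub, map_add] at h
    linear_combination h
  · have h := congrArg ξ (hcoh2 x y z (α.symm (α.symm (α.symm w))))
    rw [hm (m x _) y, hm _ y, hb (m x _) (m y z), hb (α.symm _) (m y z)] at h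
    simp only [map_sub, map_add, map_neg, LinearMap.sub_apply] at h
    linear_combination h
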